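/- Let Ω ⊂ ℍⁿ be a bounded open set with C¹ boundary that is strictly starshaped with respect to the origin, and suppose Ω satisfies the interior gauge ball property at a point z ∈ ∂Ω, with interior tangent gauge ball B_ρ(z₂,R) (so B_ρ(z₂,R) ⊂ Ω and closure(B_ρ(z₂,R)) ∩ ∂Ω = {z}). Then there exists λ̄ > 0 such that δ_{−λ}(z) ∈ B_ρ(z₂,R) for every λ with 0 < λ < λ̄. -/

import Mathlib

open MeasureTheory Real Set

noncomputable section

/-- The underlying space of the Heisenberg group `ℍⁿ`, i.e. `ℝ^(2n+1)`,
with coordinates `(x₁, …, xₙ, y₁, …, yₙ, t)`. -/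
abbrev Heis (n : ℕ) := Fin (2 * n + 1) → ℝ

namespace Heis

variable {n : ℕ}

/-- The index of the coordinate `xᵢ`. -/
def xIdx (n : ℕ) (i : Fin n) : Fin (2 * n + 1) := ⟨(i : ℕ), by have := i.isLt; omega⟩

/-- The index of the coordinate `yᵢ`. -/
def yIdx (n : ℕ) (i : Fin n) : Fin (2 * n + 1) := ⟨n + (i : ℕ), by have := i.isLt; omega⟩

/-- The index of the coordinate `t`. -/
def tIdx (n : ℕ) : Fin (2 * n + 1) := ⟨2 * n, by omega⟩

/-- The Heisenberg group product. -/
def mul (z w : Heis n) : Heis n := fun k =>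
  if (k : ℕ) = 2 * n then
    z k + w k + 2 * ∑ i : Fin n,
      (w (xIdx n i) * z (yIdx n i) - z (xIdx n i) * w (yIdx n i))
  else z k + w k

/-- The Heisenberg group inverse. -/
def inv (z : Heis n) : Heis n := fun k => - z k

/-- The Koranyi gauge `ρ`. -/
def rho (z : Heis n) : ℝ :=
  ((∑ i : Fin n, (z (xIdx n i) ^ 2 + z (yIdx n i) ^ 2)) ^ 2 + z (tIdx n) ^ 2) ^ ((1 : ℝ) / 4)

/-- The gauge ball `B_ρ(z, R) = {w | ρ(w⁻¹ ⬝ z) < R}`. -/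
def gaugeBall (z : Heis n) (R : ℝ) : Set (Heis n) := {w | rho (mul (inv w) z) < R}

/-- The anisotropic dilations `δ_λ`. -/
def dil (lam : ℝ) (z : Heis n) : Heis n := fun k =>
  if (k : ℕ) = 2 * n then Real.exp (2 * lam) * z k else Real.exp lam * z k

/-- The dilation-generating vector field `Z(z) = (x₁, …, xₙ, y₁, …, yₙ, 2t)`. -/
def Zvf (z : Heis n) : Heis n := fun k => if (k : ℕ) = 2 * n then 2 * z k else z k

/-- The Euclidean scalar product of `ℝ^(2n+1)`. -/
def einner (v w : Heis n) : ℝ := ∑ k, v k * w k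

/-- The Euclidean norm of `ℝ^(2n+1)`. -/
def euclNorm (v : Heis n) : ℝ := Real.sqrt (∑ k, v k ^ 2)

/-- The Euclidean gradient of `f`, via the Fréchet derivative. -/
def grad (f : Heis n → ℝ) (z : Heis n) : Heis n := fun k => fderiv ℝ f z (Pi.single k 1)

/-- The horizontal derivative `Xᵢ f = ∂f/∂xᵢ + 2 yᵢ ∂f/∂t`. -/
def Xd (i : Fin n) (f : Heis n → ℝ) (z : Heis n) : ℝ :=
  grad f z (xIdx n i) + 2 * z (yIdx n i) * grad f z (tIdx n)

/-- The horizontal derivative `Yⱼ f = ∂f/∂yⱼ − 2 xⱼ ∂f/∂t`. -/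
def Yd (i : Fin n) (f : Heis n → ℝ) (z : Heis n) : ℝ :=
  grad f z (yIdx n i) - 2 * z (xIdx n i) * grad f z (tIdx n)

/-- The horizontal gradient `∇_ℍ f = (X₁ f, …, Xₙ f, Y₁ f, …, Yₙ f)`. -/
def hGrad (f : Heis n → ℝ) (z : Heis n) : (Fin n → ℝ) × (Fin n → ℝ) :=
  (fun i => Xd i f z, fun i => Yd i f z)

/-- The norm `|∇_ℍ f|` of the horizontal gradient. -/
def hNorm (f : Heis n → ℝ) (z : Heis n) : ℝ :=
  Real.sqrt (∑ i : Fin n, ((Xd i f z) ^ 2 + (Yd i f z) ^ 2))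

/-- `f` is weakly horizontally `p`-harmonic on the open set `U` :
`f` and `∇_ℍ f` are locally `p`-integrable on `U` and
`∫_U |∇_ℍ f|^(p−2) ⟨∇_ℍ f, ∇_ℍ φ⟩ = 0` for every `C¹` function `φ`
with compact support contained in `U` (note that `Real.rpow` makes the
integrand vanish at points where `∇_ℍ f = 0`). -/
def PHarmonicOn (p : ℝ) (f : Heis n → ℝ) (U : Set (Heis n)) : Prop :=
  LocallyIntegrableOn (fun z => |f z| ^ p) U volume ∧
  LocallyIntegrableOn (fun z => hNorm f z ^ p) U volume ∧
  ∀ φ : Heis n → ℝ, ContDiff ℝ 1 φ → HasCompactSupport φ → tsupport φ ⊆ U →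
    ∫ z in U, hNorm f z ^ (p - 2) *
      (∑ i : Fin n, (Xd i f z * Xd i φ z + Yd i f z * Yd i φ z)) = 0

/-- `Ω` has `C¹` boundary, with Euclidean outward unit normal `ν` on `∂Ω` :
near every boundary point, `Ω` is the sublevel set of a `C¹` defining function
with nonvanishing (Euclidean) gradient, and `ν` is the normalized gradient. -/
def HasC1Boundary (Ω : Set (Heis n)) (ν : Heis n → Heis n) : Prop :=
  ∀ z ∈ frontier Ω, ∃ (V : Set (Heis n)) (g : Heis n → ℝ),
    IsOpen V ∧ z ∈ V ∧ ContDiff ℝ 1 g ∧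
    (∀ w ∈ V, (w ∈ interior Ω ↔ g w < 0)) ∧
    (∀ w ∈ V, (w ∈ frontier Ω ↔ g w = 0)) ∧
    (∀ w ∈ V, w ∈ frontier Ω →
      grad g w ≠ 0 ∧ ν w = (euclNorm (grad g w))⁻¹ • grad g w)

/-- `Ω` (with `C¹` boundary and Euclidean outward unit normal `ν`) is strictly
starshaped with respect to the origin : it contains the origin and `⟨ν, Z⟩ > 0`
everywhere on `∂Ω`. -/
def StrictStarshaped (Ω : Set (Heis n)) (ν : Heis n → Heis n) : Prop :=
  (0 : Heis n) ∈ Ω ∧ HasC1Boundary Ω ν ∧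
    ∀ z ∈ frontier Ω, 0 < einner (ν z) (Zvf z)

/-- `Ω` satisfies the exterior gauge ball property at `z ∈ ∂Ω`, with exterior
tangent gauge ball `B_ρ(z₁, R)`. -/
def ExteriorGaugeBallAt (Ω : Set (Heis n)) (z z₁ : Heis n) (R : ℝ) : Prop :=
  z₁ ∉ closure Ω ∧ gaugeBall z₁ R ⊆ (closure Ω)ᶜ ∧
    closure (gaugeBall z₁ R) ∩ frontier Ω = {z}

/-- `Ω` satisfies a uniform exterior gauge ball property. -/
def UniformExteriorGaugeBall (Ω : Set (Heis n)) : Prop :=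
  ∃ R > 0, ∀ z ∈ frontier Ω, ∃ z₁, ExteriorGaugeBallAt Ω z z₁ R

/-- `Ω` satisfies the interior gauge ball property at `z ∈ ∂Ω`, with interior
tangent gauge ball `B_ρ(z₂, R)`. -/
def InteriorGaugeBallAt (Ω : Set (Heis n)) (z z₂ : Heis n) (R : ℝ) : Prop :=
  z₂ ∈ Ω ∧ gaugeBall z₂ R ⊆ Ω ∧ closure (gaugeBall z₂ R) ∩ frontier Ω = {z}

/-- `Ω` satisfies a uniform interior gauge ball property. -/
def UniformInteriorGaugeBall (Ω : Set (Heis n)) : Prop :=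
  ∃ R > 0, ∀ z ∈ frontier Ω, ∃ z₂, InteriorGaugeBallAt Ω z z₂ R

end Heis

lemma hasDerivAt_add_smul {E : Type*} [NormedAddCommGroup E] [NormedSpace ℝ E] (z v : E) :
    HasDerivAt (fun s : ℝ => z + s • v) v 0 := by
  simpa using ((hasDerivAt_id (0 : ℝ)).smul_const v).const_add z

namespace Heis

variable {n : ℕ}

/-- The fourth power of the Koranyi gauge, as a polynomial. -/
def gaugePoly (z : Heis n) : ℝ :=
  (∑ i : Fin n, (z (xIdx n i) ^ 2 + z (yIdx n i) ^ 2)) ^ 2 + z (tIdx n) ^ 2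

lemma gaugePoly_nonneg (z : Heis n) : 0 ≤ gaugePoly z := by
  unfold gaugePoly; positivity

lemma mem_gaugeBall_iff {z w : Heis n} {R : ℝ} (hR : 0 < R) :
    w ∈ gaugeBall z R ↔ gaugePoly (mul (inv w) z) < R ^ 4 := by
  have h : R = (R ^ 4) ^ ((1 : ℝ) / 4) := by
    rw [← Real.rpow_natCast, ← Real.rpow_mul hR.le]; norm_num
  change gaugePoly (mul (inv w) z) ^ ((1 : ℝ) / 4) < R ↔ _
  conv_lhs => rw [h]
  exact Real.rpow_lt_rpow_iff (gaugePoly_nonneg _) (by positivity) (by norm_num)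

lemma differentiable_gaugePoly : Differentiable ℝ (gaugePoly : Heis n → ℝ) := by
  unfold gaugePoly; fun_prop

lemma differentiable_mul_inv (z : Heis n) : Differentiable ℝ fun w : Heis n => mul (inv w) z := by
  rw [differentiable_pi]
  intro k
  unfold mul inv
  split_ifs <;> fun_prop

lemma mul_inv_add_smul_sub (z w : Heis n) (s : ℝ) :
    mul (inv (w + s • (z - w))) z = (1 - s) • mul (inv w) z := by
  funext k
  simp only [mul, inv, Pi.add_apply, Pi.smul_apply, Pi.sub_apply, smul_eq_mul]
  split_ifs
  · rw [mul_add, mul_left_comm (1 - s) 2]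
    congr 1
    · ring
    · congr 1
      rw [Finset.mul_sum]
      exact Finset.sum_congr rfl fun i _ => by ring
  · ring

lemma gaugePoly_smul (r : ℝ) (z : Heis n) :
    gaugePoly (r • z) =
      r ^ 4 * (∑ i : Fin n, (z (xIdx n i) ^ 2 + z (yIdx n i) ^ 2)) ^ 2 + r ^ 2 * z (tIdx n) ^ 2 := by
  simp only [gaugePoly, Pi.smul_apply, smul_eq_mul, mul_pow, ← mul_add, ← Finset.mul_sum]
  ring

lemma hasDerivAt_dil_neg (z : Heis n) : HasDerivAt (fun s : ℝ => dil (-s) z) (-Zvf z) 0 := by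
  rw [hasDerivAt_pi]
  intro k
  simp only [dil, Zvf, Pi.neg_apply]
  split_ifs
  · have h := (((hasDerivAt_id (0 : ℝ)).neg.const_mul 2).exp).mul_const (z k)
    simpa using h
  · have h := ((hasDerivAt_id (0 : ℝ)).neg.exp).mul_const (z k)
    simpa using h

lemma dil_zero (z : Heis n) : dil 0 z = z := by
  funext k; simp [dil]

/-- The gauge polynomial decreases at first order on the segment towards the centre. -/
lemma fderiv_gaugePoly_sub_neg {z w : Heis n} (h : 0 < gaugePoly (mul (inv w) z)) :
    fderiv ℝ (fun w : Heis n => gaugePoly (mul (inv w) z)) w (z - w) < 0 := by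
  have hd : Differentiable ℝ fun w : Heis n => gaugePoly (mul (inv w) z) :=
    differentiable_gaugePoly.comp (differentiable_mul_inv z)
  set u := mul (inv w) z
  set A := (∑ i : Fin n, (u (xIdx n i) ^ 2 + u (yIdx n i) ^ 2)) ^ 2
  set T := u (tIdx n) ^ 2
  have h1 : HasDerivAt (fun s : ℝ => gaugePoly (mul (inv (w + s • (z - w))) z))
      (fderiv ℝ (fun w : Heis n => gaugePoly (mul (inv w) z)) w (z - w)) 0 :=
    (hd w).hasFDerivAt.comp_hasDerivAt_of_eq 0 (hasDerivAt_add_smul w (z - w)) (by simp)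
  have h2 : HasDerivAt (fun s : ℝ => gaugePoly (mul (inv (w + s • (z - w))) z))
      (-(4 * A + 2 * T)) 0 := by
    simp only [mul_inv_add_smul_sub, gaugePoly_smul]
    have h3 := (hasDerivAt_id (0 : ℝ)).const_sub 1
    refine (((h3.pow 4).mul_const A).add ((h3.pow 2).mul_const T)).congr_deriv ?_
    simp only [id]
    norm_num
    ring
  rw [h1.unique h2]
  have hAT : 0 < A + T := h
  have hA0 : 0 ≤ A := sq_nonneg _
  have hT0 : 0 ≤ T := sq_nonneg _
  linarith

lemma einner_grad (f : Heis n → ℝ) (z v : Heis n) : einner (grad f z) v = fderiv ℝ f z v := by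
  conv_rhs => rw [pi_eq_sum_univ' v]
  simp only [einner, grad, map_sum, map_smul, smul_eq_mul]
  refine Finset.sum_congr rfl fun k _ => ?_
  rw [mul_comm]

lemma einner_smul_left (c : ℝ) (v w : Heis n) : einner (c • v) w = c * einner v w := by
  simp [einner, Finset.mul_sum, mul_assoc]

end Heis

open Filter Topology in
lemma HasDerivAt.eventually_lt_of_neg {f : ℝ → ℝ} {f' a : ℝ} (h : HasDerivAt f f' a)
    (hf' : f' < 0) : ∀ᶠ s in 𝓝[>] a, f s < f a := by
  have hs := (hasDerivWithinAt_iff_tendsto_slope' (self_notMem_Ioi)).1 h.hasDerivWithinAt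
  filter_upwards [hs.eventually_lt_const hf', self_mem_nhdsWithin] with s hs1 hs2
  rw [slope_def_field, div_neg_iff] at hs1
  have : 0 < s - a := sub_pos.2 hs2
  rcases hs1 with h | h <;> linarith [h.1, h.2]

open Filter Topology in
/-- If `P < P z` forces `g < g z` near `z`, then the derivative of `P` is positive in every
direction in which that of `g` is, provided the derivative of `P` does not vanish. -/
lemma fderiv_pos_of_eventually_lt {E : Type*} [NormedAddCommGroup E] [NormedSpace ℝ E]
    {P g : E → ℝ} {z v v₀ : E} (hP : DifferentiableAt ℝ P z) (hg : DifferentiableAt ℝ g z)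
    (hPg : ∀ᶠ w in 𝓝 z, P w < P z → g w < g z) (hv₀ : fderiv ℝ P z v₀ < 0)
    (hv : 0 < fderiv ℝ g z v) : 0 < fderiv ℝ P z v := by
  have key : ∀ u, fderiv ℝ P z u < 0 → fderiv ℝ g z u ≤ 0 := by
    intro u hu
    by_contra! hgu
    have hP' := (hP.hasFDerivAt.comp_hasDerivAt_of_eq 0 (hasDerivAt_add_smul z u)
      (by simp)).eventually_lt_of_neg hu
    have hg' := (hg.hasFDerivAt.comp_hasDerivAt_of_eq 0 (hasDerivAt_add_smul z u)
      (by simp)).neg.eventually_lt_of_neg (neg_lt_zero.2 hgu)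
    have ht : Tendsto (fun s : ℝ => z + s • u) (𝓝[>] 0) (𝓝 z) := by
      simpa using (hasDerivAt_add_smul z u).continuousAt.tendsto.mono_left nhdsWithin_le_nhds
    obtain ⟨s, h1, h2, h3⟩ := (hP'.and (hg'.and (ht.eventually hPg))).exists
    simp only [Function.comp_apply, Pi.neg_apply, zero_smul, add_zero, neg_lt_neg_iff] at h1 h2
    exact lt_asymm h2 (h3 h1)
  by_contra! hPv
  have hc : Tendsto (fun ε : ℝ => fderiv ℝ g z (v + ε • v₀)) (𝓝[>] 0) (𝓝 (fderiv ℝ g z v)) := by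
    have : Continuous fun ε : ℝ => fderiv ℝ g z (v + ε • v₀) := by fun_prop
    simpa using (this.tendsto 0).mono_left nhdsWithin_le_nhds
  refine hv.not_ge (le_of_tendsto hc ?_)
  filter_upwards [self_mem_nhdsWithin] with ε hε
  apply key
  rw [map_add, map_smul, smul_eq_mul]
  have := mul_neg_of_pos_of_neg (mem_Ioi.1 hε) hv₀
  linarith

/-- If `Ω` is strictly starshaped and has an interior tangent
gauge ball `B_ρ(z₂, R)` at `z ∈ ∂Ω`, then the dilations `δ_{−λ}(z)` enter the
ball for all small `λ > 0`. -/
theorem dil_mem_interior_gaugeBall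
    (n : ℕ) (hn : 1 ≤ n) (Ω : Set (Heis n)) (ν : Heis n → Heis n)
    (hopen : IsOpen Ω) (hbd : Bornology.IsBounded Ω)
    (hstar : Heis.StrictStarshaped Ω ν)
    (z z₂ : Heis n) (R : ℝ) (hR : 0 < R) (hz : z ∈ frontier Ω)
    (hball : Heis.InteriorGaugeBallAt Ω z z₂ R) :
    ∃ lam > (0 : ℝ), ∀ μ : ℝ, 0 < μ → μ < lam →
      Heis.dil (-μ) z ∈ Heis.gaugeBall z₂ R := by
  obtain ⟨-, hC1, hpos⟩ := hstar
  obtain ⟨-, hsub, hcl⟩ := hball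
  obtain ⟨V, g, hV, hzV, hg, hint, hfr, hν⟩ := hC1 z hz
  set P : Heis n → ℝ := fun w => Heis.gaugePoly (Heis.mul (Heis.inv w) z₂)
  have hPd : Differentiable ℝ P :=
    Heis.differentiable_gaugePoly.comp (Heis.differentiable_mul_inv z₂)
  have hmem : ∀ w, w ∈ Heis.gaugeBall z₂ R ↔ P w < R ^ 4 := fun w => Heis.mem_gaugeBall_iff hR
  have hzc : z ∈ closure (Heis.gaugeBall z₂ R) :=
    (hcl.symm.subset (mem_singleton z)).1
  have hPz : P z = R ^ 4 := by
    refine le_antisymm ?_ ?_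
    · exact closure_minimal (fun w hw => ((hmem w).1 hw).le)
        (isClosed_le hPd.continuous continuous_const) hzc
    · by_contra! h
      rw [hopen.frontier_eq] at hz
      exact hz.2 (hsub ((hmem z).2 h))
  have hgz : g z = 0 := (hfr z hzV).1 hz
  have hPg : ∀ᶠ w in nhds z, P w < P z → g w < g z := by
    filter_upwards [hV.mem_nhds hzV] with w hw hlt
    rw [hgz]
    refine (hint w hw).1 ?_
    rw [hopen.interior_eq]
    exact hsub ((hmem w).2 (hPz ▸ hlt))
  have hgZ : 0 < fderiv ℝ g z (Heis.Zvf z) := by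
    have h := hpos z hz
    rw [(hν z hzV hz).2, Heis.einner_smul_left, Heis.einner_grad] at h
    exact pos_of_mul_pos_right h (inv_nonneg.2 (Real.sqrt_nonneg _))
  have hPZ : 0 < fderiv ℝ P z (Heis.Zvf z) :=
    fderiv_pos_of_eventually_lt (hPd z) (hg.differentiable one_ne_zero z) hPg
      (Heis.fderiv_gaugePoly_sub_neg (show 0 < P z by rw [hPz]; positivity)) hgZ
  have hev := ((hPd z).hasFDerivAt.comp_hasDerivAt_of_eq 0 (Heis.hasDerivAt_dil_neg z)
    (by simp [Heis.dil_zero])).eventually_lt_of_neg (by simpa using hPZ)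
  obtain ⟨lam, hlam, hsub'⟩ := mem_nhdsGT_iff_exists_Ioo_subset.1 hev
  refine ⟨lam, hlam, fun μ h0 h1 => (hmem _).2 ?_⟩
  have h := hsub' ⟨h0, h1⟩
  simpa [Heis.dil_zero, hPz] using h
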